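/- Let R > 0, let ψ̄ : ℝ² × ℝ → ℝ be twice continuously differentiable in the spatial variables, let ξ̄, ψ_σ : ℝ² × ℝ → ℝ be continuously differentiable with ∂_t ξ̄ + [ψ̄, ξ̄] = R⁻²[ψ̄, ψ_σ] and ∂_t ψ_σ + [ψ̄, ψ_σ] = 0 everywhere (the IL⁰QG equations), and let F, G, H : ℝ → ℝ be continuously differentiable with H′ = F. Then the Casimir density satisfies the local conservation law ∂_t(ξ̄ F(ψ_σ) + G(ψ_σ)) + div((ξ̄ F(ψ_σ) + G(ψ_σ) − R⁻² H(ψ_σ)) ∇⊥ψ̄) = 0 at every point. -/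

import Mathlib

noncomputable section

/-- Partial derivative in the first spatial coordinate. -/
def pdx (f : ℝ × ℝ → ℝ) (p : ℝ × ℝ) : ℝ := fderiv ℝ f p ((1 : ℝ), (0 : ℝ))

/-- Partial derivative in the second spatial coordinate. -/
def pdy (f : ℝ × ℝ → ℝ) (p : ℝ × ℝ) : ℝ := fderiv ℝ f p ((0 : ℝ), (1 : ℝ))

/-- The Jacobian (canonical Poisson) bracket `[a,b] = a_x b_y - a_y b_x`. -/
def jb (a b : ℝ × ℝ → ℝ) (p : ℝ × ℝ) : ℝ := pdx a p * pdy b p - pdy a p * pdx b p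

/-- Perpendicular gradient `∇⊥ψ = (-ψ_y, ψ_x)`. -/
def pgrad (ψ : ℝ × ℝ → ℝ) (p : ℝ × ℝ) : ℝ × ℝ := (-(pdy ψ p), pdx ψ p)

/-- Gradient `∇ψ = (ψ_x, ψ_y)`. -/
def grad2 (ψ : ℝ × ℝ → ℝ) (p : ℝ × ℝ) : ℝ × ℝ := (pdx ψ p, pdy ψ p)

/-- Divergence of a planar vector field. -/
def div2 (v : ℝ × ℝ → ℝ × ℝ) (p : ℝ × ℝ) : ℝ :=
  pdx (fun q => (v q).1) p + pdy (fun q => (v q).2) p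

/-- Laplacian of a scalar field. -/
def lap2 (ψ : ℝ × ℝ → ℝ) (p : ℝ × ℝ) : ℝ := pdx (pdx ψ) p + pdy (pdy ψ) p

/-- Time derivative of a time-dependent field on ℝ² × ℝ. -/
def pdt (f : (ℝ × ℝ) × ℝ → ℝ) (z : (ℝ × ℝ) × ℝ) : ℝ :=
  fderiv ℝ f z ((0 : ℝ × ℝ), (1 : ℝ))

/-- Jacobian bracket of time-dependent fields, acting in the spatial variables at fixed time. -/
def jbt (a b : (ℝ × ℝ) × ℝ → ℝ) (z : (ℝ × ℝ) × ℝ) : ℝ :=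
  jb (fun q => a (q, z.2)) (fun q => b (q, z.2)) z.1

/-- A field that is twice continuously differentiable has commuting mixed partial derivatives. -/
theorem pdx_pdy_comm {ψ : ℝ × ℝ → ℝ} (hψ : ContDiff ℝ 2 ψ) (p : ℝ × ℝ) :
    pdx (pdy ψ) p = pdy (pdx ψ) p := by
  have hd : DifferentiableAt ℝ (fderiv ℝ ψ) p :=
    ((hψ.fderiv_right (m := 1) (by norm_num)).differentiable (by norm_num)) p
  have hs : IsSymmSndFDerivAt ℝ ψ p := hψ.contDiffAt.isSymmSndFDerivAt (by simp)
  have key : ∀ v w : ℝ × ℝ,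
      fderiv ℝ (fun q => fderiv ℝ ψ q v) p w = fderiv ℝ (fderiv ℝ ψ) p w v := fun v w => by
    rw [fderiv_clm_apply hd (differentiableAt_const v)]
    simp
  exact (key _ _).trans ((hs _ _).trans (key _ _).symm)

/-- First partial derivatives of a `C²` field are differentiable. -/
theorem differentiable_fderiv_apply {ψ : ℝ × ℝ → ℝ} (hψ : ContDiff ℝ 2 ψ) (v : ℝ × ℝ) :
    Differentiable ℝ (fun q => fderiv ℝ ψ q v) :=
  ((hψ.fderiv_right (m := 1) (by norm_num)).differentiable (by norm_num)).clm_apply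
    (differentiable_const v)

/-- Transport by the divergence-free field `∇⊥ψ`: `div (A ∇⊥ψ) = [ψ, A]`. -/
theorem div2_smul_pgrad {A ψ : ℝ × ℝ → ℝ} {p : ℝ × ℝ} (hA : DifferentiableAt ℝ A p)
    (hψ : ContDiff ℝ 2 ψ) : div2 (fun q => A q • pgrad ψ q) p = jb ψ A p := by
  have hx : DifferentiableAt ℝ (pdx ψ) p := differentiable_fderiv_apply hψ _ p
  have hy : DifferentiableAt ℝ (pdy ψ) p := differentiable_fderiv_apply hψ _ p
  have h1 : pdx (fun q => A q * -pdy ψ q) p = -(A p * pdx (pdy ψ) p) - pdy ψ p * pdx A p := by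
    simp only [pdx]
    rw [fderiv_fun_mul hA hy.fun_neg, fderiv_fun_neg]
    simp
    ring
  have h2 : pdy (fun q => A q * pdx ψ q) p = A p * pdy (pdx ψ) p + pdx ψ p * pdy A p := by
    simp only [pdy]
    rw [fderiv_fun_mul hA hx]
    simp
  change pdx (fun q => A q * -pdy ψ q) p + pdy (fun q => A q * pdx ψ q) p = _
  rw [h1, h2, pdx_pdy_comm hψ, jb]
  ring

/-- Chain rule for the Casimir flux density `ξ F(σ) + G(σ) - c H(σ)`, where `H` is a primitive of `F`. -/
theorem hasFDerivAt_casimir_flux {E : Type*} [NormedAddCommGroup E] [NormedSpace ℝ E]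
    {ξ σ : E → ℝ} {F G H : ℝ → ℝ} {p : E} (c : ℝ)
    (hξ : DifferentiableAt ℝ ξ p) (hσ : DifferentiableAt ℝ σ p)
    (hF : DifferentiableAt ℝ F (σ p)) (hG : DifferentiableAt ℝ G (σ p))
    (hH : HasDerivAt H (F (σ p)) (σ p)) :
    HasFDerivAt (fun q => ξ q * F (σ q) + G (σ q) - c * H (σ q))
      (F (σ p) • fderiv ℝ ξ p
        + (ξ p * deriv F (σ p) + deriv G (σ p) - c * F (σ p)) • fderiv ℝ σ p) p := by
  have h1 := hF.hasDerivAt.comp_hasFDerivAt p hσ.hasFDerivAt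
  have h2 := hG.hasDerivAt.comp_hasFDerivAt p hσ.hasFDerivAt
  have h3 := hH.comp_hasFDerivAt p hσ.hasFDerivAt
  refine (((hξ.hasFDerivAt.mul h1).add h2).sub (h3.const_mul c)).congr_fderiv ?_
  ext v
  simp
  ring

/-- local (flux) form of the IL⁰QG Casimirs `∫ (ξ̄ F(ψ_σ) + G(ψ_σ)) d²x`. -/
theorem il0qg_casimir_local_conservation_law (R : ℝ) (hR : 0 < R)
    (ψbar ξbar ψσ : (ℝ × ℝ) × ℝ → ℝ)
    (hψbar : ∀ t : ℝ, ContDiff ℝ 2 (fun q : ℝ × ℝ => ψbar (q, t)))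
    (hξbar : ContDiff ℝ 1 ξbar) (hψσ : ContDiff ℝ 1 ψσ)
    (heq1 : ∀ z : (ℝ × ℝ) × ℝ, pdt ξbar z + jbt ψbar ξbar z = (R ^ 2)⁻¹ * jbt ψbar ψσ z)
    (heq2 : ∀ z : (ℝ × ℝ) × ℝ, pdt ψσ z + jbt ψbar ψσ z = 0)
    (F G H : ℝ → ℝ) (hF : ContDiff ℝ 1 F) (hG : ContDiff ℝ 1 G) (hH : ContDiff ℝ 1 H)
    (hH' : ∀ s : ℝ, HasDerivAt H (F s) s)
    (z : (ℝ × ℝ) × ℝ) :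
    pdt (fun w => ξbar w * F (ψσ w) + G (ψσ w)) z
      + div2 (fun q =>
          (ξbar (q, z.2) * F (ψσ (q, z.2)) + G (ψσ (q, z.2)) - (R ^ 2)⁻¹ * H (ψσ (q, z.2))) •
          pgrad (fun q' => ψbar (q', z.2)) q) z.1 = 0 := by
  have hξd : Differentiable ℝ ξbar := hξbar.differentiable (by norm_num)
  have hσd : Differentiable ℝ ψσ := hψσ.differentiable (by norm_num)
  have hFd : Differentiable ℝ F := hF.differentiable (by norm_num)
  have hGd : Differentiable ℝ G := hG.differentiable (by norm_num)
  have hslice : Differentiable ℝ (fun q : ℝ × ℝ => (q, z.2)) := by fun_prop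
  have ht := hasFDerivAt_casimir_flux 0 (hξd z) (hσd z) (hFd _) (hGd _) (hH' _)
  have hs := hasFDerivAt_casimir_flux (ξ := fun q => ξbar (q, z.2)) (σ := fun q => ψσ (q, z.2))
    (p := z.1) (R ^ 2)⁻¹ ((hξd.comp hslice) z.1) ((hσd.comp hslice) z.1) (hFd _) (hGd _) (hH' _)
  simp only [zero_mul, sub_zero] at ht
  rw [div2_smul_pgrad hs.differentiableAt (hψbar z.2)]
  have e1 := heq1 z
  have e2 := heq2 z
  simp only [pdt, jbt, jb, pdx, pdy] at e1 e2 ⊢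
  rw [ht.fderiv, hs.fderiv]
  simp only [add_apply, smul_apply, smul_eq_mul, Prod.mk.eta]
  linear_combination F (ψσ z) * e1 + (ξbar z * deriv F (ψσ z) + deriv G (ψσ z)) * e2
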